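/- Let D ≤ −3 be a fundamental discriminant. Then the limit lim_{x→∞} Σ_{p ≤ x} (D/p)·(log p)/(p − 1) (sum over primes p ≤ x) exists, and its negative equals (L'/L)(1, χ_D) + Σ_{p : (D/p) = −1} 2·(log p)/(p² − 1), where the last sum over primes converges absolutely. -/

import Mathlib

open Filter Real
open scoped Classical

/-- The Kronecker symbol `(D/p)` at a prime `p`: it is `0` if `p ∣ D`, equals the
Jacobi symbol `(D|p)` for odd `p ∤ D`, and for `p = 2 ∤ D` equals `1` if
`D ≡ 1 (mod 8)` and `-1` if `D ≡ 5 (mod 8)`. -/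
def kron (D : ℤ) (p : ℕ) : ℤ :=
  if (p : ℤ) ∣ D then 0
  else if p = 2 then (if D % 8 = 1 then 1 else -1)
  else jacobiSym D p

/-- `D` is a fundamental discriminant: either `D ≡ 1 (mod 4)` and `D` is squarefree,
or `D = 4m` with `m` squarefree and `m ≡ 2` or `3 (mod 4)`. -/
def IsFundamentalDiscriminant (D : ℤ) : Prop :=
  (D % 4 = 1 ∧ Squarefree D) ∨
  (∃ m : ℤ, D = 4 * m ∧ Squarefree m ∧ (m % 4 = 2 ∨ m % 4 = 3))

/-- `S_D`: the multiplicative semigroup generated by the primes `p` with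
`(D/p) = 1` together with the squares of the primes `q` with `(D/q) = -1`;
equivalently, the positive integers `n` such that every prime `p ∣ n` has
`(D/p) = 1`, or `(D/p) = -1` and `p` occurs in `n` to an even exponent. -/
def SD (D : ℤ) : Set ℕ :=
  {n : ℕ | 0 < n ∧ ∀ p : ℕ, p.Prime → p ∣ n →
    (kron D p = 1 ∨ (kron D p = -1 ∧ Even (n.factorization p)))}

/-- `χ` is the completely multiplicative function `χ_D` with `χ_D(p) = (D/p)` on
primes. -/
def IsChiD (D : ℤ) (χ : ℕ → ℤ) : Prop :=
  χ 0 = 0 ∧ χ 1 = 1 ∧ (∀ m n : ℕ, χ (m * n) = χ m * χ n) ∧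
    ∀ p : ℕ, p.Prime → χ p = kron D p

/-- `L(s,χ) = ∑_{n ≥ 1} χ(n) n^{-s}` (for real `s > 1`). -/
noncomputable def LChi (χ : ℕ → ℤ) (s : ℝ) : ℝ :=
  ∑' n : ℕ, (χ n : ℝ) * (n : ℝ) ^ (-s)

/-- `L'(s,χ) = -∑_{n ≥ 1} χ(n) (log n) n^{-s}` (for real `s > 1`). -/
noncomputable def LChi' (χ : ℕ → ℤ) (s : ℝ) : ℝ :=
  -∑' n : ℕ, (χ n : ℝ) * Real.log n * (n : ℝ) ^ (-s)

/-- The Riemann zeta function `ζ(s) = ∑_{n ≥ 1} n^{-s}` (for real `s > 1`). -/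
noncomputable def zetaR (s : ℝ) : ℝ := ∑' n : ℕ, (n : ℝ) ^ (-s)

/-- `ζ'(s) = -∑_{n ≥ 1} (log n) n^{-s}` (for real `s > 1`). -/
noncomputable def zetaR' (s : ℝ) : ℝ := -∑' n : ℕ, Real.log n * (n : ℝ) ^ (-s)

section Tauberian

open MeasureTheory FourierTransform

/-- A compactly supported function whose Fourier transform is an integrable kernel of total mass
one with finite first moment. -/
lemma exists_compactSupport_fourier_kernel : ∃ φ : ℝ → ℂ, Continuous φ ∧ HasCompactSupport φ ∧
    Continuous (𝓕 φ) ∧ Integrable (𝓕 φ) ∧ Integrable (fun u => |u| * ‖𝓕 φ u‖) ∧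
    ∫ u, 𝓕 φ u = 1 := by
  let b : ContDiffBump (0 : ℝ) := ⟨1, 2, by norm_num, by norm_num⟩
  have hsupp : HasCompactSupport (fun x => (b x : ℂ)) := by
    refine b.hasCompactSupport.comp_left (g := fun x : ℝ => (x : ℂ)) (by simp)
  have hsm : ContDiff ℝ (⊤ : ℕ∞) (fun x => (b x : ℂ)) :=
    Complex.ofRealCLM.contDiff.comp b.contDiff
  let f := hsupp.toSchwartzMap hsm
  have hf : (f : ℝ → ℂ) = fun x => (b x : ℂ) := by
    ext x; rfl
  have hF : (𝓕 f : SchwartzMap ℝ ℂ) = 𝓕 (fun x => (b x : ℂ)) := by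
    rw [SchwartzMap.fourier_coe, hf]
  refine ⟨fun x => (b x : ℂ), hsm.continuous, hsupp, ?_, ?_, ?_, ?_⟩
  · rw [← hF]; exact (𝓕 f).continuous
  · rw [← hF]; exact (𝓕 f).integrable
  · rw [← hF]; exact ((𝓕 f).integrable_pow_mul volume 1).congr (.of_forall fun u => by
      simp only [pow_one, Real.norm_eq_abs])
  · have h := congrFun (f.continuous.fourierInv_fourier_eq f.integrable
      (by rw [← SchwartzMap.fourier_coe]; exact (𝓕 f).integrable)) 0
    rw [hf, Real.fourierInv_eq'] at h
    simpa [b.one_of_mem_closedBall (x := 0) (by simp [b])] using h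

/-- The smoothed form of the Laplace transform identity, via Fubini. -/
lemma integral_mul_fourier_eq_integral_laplace {φ : ℝ → ℂ} (hφ : Continuous φ)
    (hφc : HasCompactSupport φ) {f : ℝ → ℂ} (hf : Measurable f) {M : ℝ} (hM : ∀ t, ‖f t‖ ≤ M)
    {g : ℂ → ℂ}
    (hg : ∀ s : ℂ, 0 < s.re → ∫ t in Set.Ioi (0 : ℝ), f t * Complex.exp (-s * t) = g s)
    {σ : ℝ} (hσ : 0 < σ) (T : ℝ) :
    ∫ t in Set.Ioi (0 : ℝ), f t * Complex.exp (-σ * t) * 𝓕 φ (T - t) =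
      ∫ y, Complex.exp (↑(-2 * π * y * T) * Complex.I) *
        (φ y * g (σ - 2 * π * y * Complex.I)) := by
  have hexp : IntegrableOn (fun t : ℝ => f t * Complex.exp (-σ * t)) (Set.Ioi 0) := by
    have h0 : IntegrableOn (fun t : ℝ => M * Real.exp (-σ * t)) (Set.Ioi 0) :=
      (integrableOn_exp_mul_Ioi (by linarith) 0).const_mul M
    refine h0.mono' (by fun_prop) (.of_forall fun t => ?_)
    rw [norm_mul, Complex.norm_exp]
    simpa using mul_le_mul_of_nonneg_right (hM t) (Real.exp_pos (-(σ * t))).le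
  have hφi : Integrable φ := hφ.integrable_of_hasCompactSupport hφc
  have h_int : Integrable (fun z : ℝ × ℝ => (f z.1 * Complex.exp (-σ * z.1)) *
      (Complex.exp (↑(-2 * π * z.2 * (T - z.1)) * Complex.I) * φ z.2))
      ((volume.restrict (Set.Ioi 0)).prod volume) := by
    refine (hexp.mul_prod hφi).mono (by fun_prop) (.of_forall fun z => ?_)
    simp only [norm_mul]
    rw [Complex.norm_exp_ofReal_mul_I, one_mul]
  calc _ = ∫ t in Set.Ioi (0 : ℝ), ∫ y, (f t * Complex.exp (-σ * t)) *
      (Complex.exp (↑(-2 * π * y * (T - t)) * Complex.I) * φ y) := by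
        refine integral_congr_ae (.of_forall fun t => ?_)
        simp only [Real.fourier_real_eq_integral_exp_smul, smul_eq_mul]
        rw [integral_const_mul]
    _ = ∫ y, ∫ t in Set.Ioi (0 : ℝ), (f t * Complex.exp (-σ * t)) *
      (Complex.exp (↑(-2 * π * y * (T - t)) * Complex.I) * φ y) := integral_integral_swap h_int
    _ = _ := by
        refine integral_congr_ae (.of_forall fun y => ?_)
        simp only
        rw [← hg _ (by simpa using hσ), ← integral_const_mul, ← integral_const_mul]
        refine integral_congr_ae (.of_forall fun t => ?_)
        have : Complex.exp (-σ * t) * Complex.exp (↑(-2 * π * y * (T - t)) * Complex.I) =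
            Complex.exp (↑(-2 * π * y * T) * Complex.I) *
              Complex.exp (-(σ - 2 * π * y * Complex.I) * t) := by
          rw [← Complex.exp_add, ← Complex.exp_add]
          congr 1
          push_cast; ring
        simp only
        linear_combination f t * φ y * this

lemma tendsto_integral_mul_fourier_of_laplace {φ : ℝ → ℂ} (hφ : Continuous φ)
    (hφc : HasCompactSupport φ) (hK : Continuous (𝓕 φ)) (hKi : Integrable (𝓕 φ))
    {f : ℝ → ℂ} (hf : Measurable f) {M : ℝ} (hM : ∀ t, ‖f t‖ ≤ M)
    {g : ℂ → ℂ} (hgc : ContinuousOn g {s | 0 ≤ s.re})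
    (hg : ∀ s : ℂ, 0 < s.re → ∫ t in Set.Ioi (0 : ℝ), f t * Complex.exp (-s * t) = g s) :
    Tendsto (fun T : ℝ => ∫ t in Set.Ioi (0 : ℝ), f t * 𝓕 φ (T - t)) atTop (nhds 0) := by
  have key (T : ℝ) : ∫ t in Set.Ioi (0 : ℝ), f t * 𝓕 φ (T - t) =
      𝓕 (fun y : ℝ => φ y * g (-(2 * π * y * Complex.I))) T := by
    have hu : Tendsto (fun n : ℕ => (1 : ℝ) / (n + 1)) atTop (nhds 0) :=
      tendsto_one_div_add_atTop_nhds_zero_nat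
    have hKT : Integrable (fun t => 𝓕 φ (T - t)) := hKi.comp_sub_left T
    have h1 : Tendsto (fun n : ℕ => ∫ t in Set.Ioi (0 : ℝ),
        f t * Complex.exp (-((1 : ℝ) / (n + 1) : ℝ) * t) * 𝓕 φ (T - t)) atTop
        (nhds (∫ t in Set.Ioi (0 : ℝ), f t * 𝓕 φ (T - t))) := by
      refine tendsto_integral_of_dominated_convergence (fun t => M * ‖𝓕 φ (T - t)‖) ?_
        (hKT.norm.const_mul M).integrableOn ?_ ?_
      · intro n; fun_prop
      · intro n
        refine (ae_restrict_iff' measurableSet_Ioi).2 (.of_forall fun t ht => ?_)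
        rw [norm_mul, norm_mul, Complex.norm_exp]
        refine mul_le_mul_of_nonneg_right ?_ (norm_nonneg _)
        refine mul_le_of_le_one_right (norm_nonneg _) ?_ |>.trans (hM t)
        rw [Real.exp_le_one_iff]
        have ht' : (0 : ℝ) < t := ht
        have : (0 : ℝ) ≤ 1 / (n + 1) * t := by positivity
        rw [← Complex.ofReal_neg, ← Complex.ofReal_mul, Complex.ofReal_re]
        linarith
      · refine .of_forall fun t => ?_
        have : Tendsto (fun n : ℕ => f t * Complex.exp (-((1 : ℝ) / (n + 1) : ℝ) * t) *
            𝓕 φ (T - t)) atTop (nhds (f t * Complex.exp (-((0 : ℝ) : ℂ) * t) * 𝓕 φ (T - t))) := by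
          refine Tendsto.mul_const _ (Tendsto.const_mul _ ?_)
          have hc : Continuous fun x : ℝ => Complex.exp (-(x : ℂ) * t) := by fun_prop
          exact (hc.tendsto 0).comp hu
        simpa using this
    have hcs : IsCompact ((fun p : ℝ × ℝ => ((p.1 : ℂ) - 2 * π * p.2 * Complex.I)) ''
        (Set.Icc 0 1 ×ˢ tsupport φ)) :=
      (isCompact_Icc.prod hφc).image (by fun_prop)
    obtain ⟨B, hB⟩ := hcs.exists_bound_of_continuousOn (f := g) (hgc.mono (by
      rintro _ ⟨p, hp, rfl⟩
      simpa using hp.1.1))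
    have hcont (σ : ℝ) (hσ : 0 ≤ σ) :
        Continuous fun y : ℝ => g (σ - 2 * π * y * Complex.I) := by
      refine hgc.comp_continuous (by fun_prop) fun y => by simpa using hσ
    have h2 : Tendsto (fun n : ℕ => ∫ y, Complex.exp (↑(-2 * π * y * T) * Complex.I) *
        (φ y * g (((1 : ℝ) / (n + 1) : ℝ) - 2 * π * y * Complex.I))) atTop
        (nhds (∫ y, Complex.exp (↑(-2 * π * y * T) * Complex.I) *
        (φ y * g (((0 : ℝ) : ℂ) - 2 * π * y * Complex.I)))) := by
      refine tendsto_integral_of_dominated_convergence (fun y => ‖φ y‖ * B) ?_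
        ((hφ.integrable_of_hasCompactSupport hφc).norm.mul_const B) ?_ ?_
      · intro n
        have := hcont ((1 : ℝ) / (n + 1)) (by positivity)
        exact (Continuous.mul (by fun_prop) (hφ.mul this)).aestronglyMeasurable
      · intro n
        refine .of_forall fun y => ?_
        rw [norm_mul, Complex.norm_exp_ofReal_mul_I, one_mul, norm_mul]
        by_cases hy : y ∈ tsupport φ
        · refine mul_le_mul_of_nonneg_left ?_ (norm_nonneg _)
          refine hB _ ⟨((1 : ℝ) / (n + 1), y), ⟨⟨by positivity, ?_⟩, hy⟩, rfl⟩
          simp only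
          rw [div_le_one (by positivity)]
          linarith [Nat.cast_nonneg (α := ℝ) n]
        · simp [image_eq_zero_of_notMem_tsupport hy]
      · refine .of_forall fun y => Tendsto.const_mul _ (Tendsto.const_mul _ ?_)
        have h3 := hgc (((0 : ℝ) : ℂ) - 2 * π * y * Complex.I) (by simp)
        refine h3.tendsto.comp (tendsto_nhdsWithin_iff.2 ⟨?_, .of_forall fun n => ?_⟩)
        · have hc : Continuous fun x : ℝ => (x : ℂ) - 2 * π * y * Complex.I := by fun_prop
          exact (hc.tendsto 0).comp hu
        · have h4 : (0 : ℝ) ≤ 1 / (n + 1) := by positivity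
          rw [Set.mem_ofPred_eq, Complex.sub_re, Complex.ofReal_re]
          simpa only [Complex.mul_re, Complex.ofReal_re, Complex.I_re, mul_zero, Complex.ofReal_im,
            Complex.I_im, Complex.re_ofNat, Complex.im_ofNat, Complex.mul_im, sub_zero, zero_mul,
            add_zero, mul_one, sub_self] using h4
    have h3 := tendsto_nhds_unique h1 (h2.congr fun n =>
      (integral_mul_fourier_eq_integral_laplace hφ hφc hf hM hg
        (by positivity : (0 : ℝ) < 1 / (n + 1)) T).symm)
    rw [h3, Real.fourier_real_eq_integral_exp_smul]
    simp
  simp_rw [key]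
  exact (Real.zero_at_infty_fourier _).mono_left atTop_le_cocompact

/-- A quantitative Tauberian theorem: the oscillation of `f` controls its size at infinity. -/
lemma exists_forall_eventually_norm_le_of_laplace : ∃ C : ℝ, 0 < C ∧ ∀ (f : ℝ → ℂ) (M κ : ℝ)
    (g : ℂ → ℂ), Measurable f → (∀ t, ‖f t‖ ≤ M) → (∀ t ≤ 0, f t = 0) →
    (∀ ε > 0, ∀ᶠ T in atTop, ∀ v, ‖f T - f (T - v)‖ ≤ κ * |v| + ε) →
    ContinuousOn g {s | 0 ≤ s.re} →
    (∀ s : ℂ, 0 < s.re → ∫ t in Set.Ioi (0 : ℝ), f t * Complex.exp (-s * t) = g s) →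
    ∀ ε > 0, ∀ᶠ T in atTop, ‖f T‖ ≤ κ * C + ε := by
  obtain ⟨φ, hφ, hφc, hK, hKi, hKm, hK1⟩ := exists_compactSupport_fourier_kernel
  set K := 𝓕 φ with hKdef
  set A := ∫ u, ‖K u‖ with hA
  set B := ∫ u, |u| * ‖K u‖ with hB
  have hA0 : 0 ≤ A := integral_nonneg fun _ => norm_nonneg _
  have hB0 : 0 ≤ B := integral_nonneg fun _ => by positivity
  refine ⟨B + 1, by positivity, fun f M κ g hf hM hf0 hosc hgc hg ε hε => ?_⟩
  have hκ : 0 ≤ κ := by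
    by_contra! h
    obtain ⟨T, hT⟩ := (hosc 1 one_pos).exists
    have h1 := (norm_nonneg _).trans (hT (-2 / κ))
    rw [abs_of_pos (div_pos_of_neg_of_neg (by norm_num) h), mul_div_cancel₀ _ h.ne] at h1
    norm_num at h1
  have hlim := tendsto_integral_mul_fourier_of_laplace hφ hφc hK hKi hf hM hgc hg
  have e1 : ∀ᶠ T in atTop, ‖∫ t in Set.Ioi (0 : ℝ), f t * K (T - t)‖ < ε / 2 := by
    simpa using (Metric.tendsto_nhds.1 hlim) (ε / 2) (by positivity)
  filter_upwards [e1, hosc (ε / (2 * (A + 1))) (by positivity)] with T h1 h2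
  have hset : ∫ t in Set.Ioi (0 : ℝ), f t * K (T - t) = ∫ u, f (T - u) * K u := by
    rw [setIntegral_eq_integral_of_forall_compl_eq_zero
      (fun t ht => by rw [hf0 t (by simpa using ht), zero_mul])]
    rw [← integral_sub_left_eq_self _ volume T]
    simp
  have hi1 : Integrable fun u => f (T - u) * K u :=
    hKi.bdd_mul (c := M)
      (hf.comp (measurable_const.sub measurable_id)).aestronglyMeasurable (.of_forall fun u => hM _)
  have hdiff : f T - ∫ u, f (T - u) * K u = ∫ u, (f T - f (T - u)) * K u := by
    calc _ = (∫ u, f T * K u) - ∫ u, f (T - u) * K u := by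
          rw [integral_const_mul, hK1, mul_one]
      _ = _ := by
          rw [← integral_sub (hKi.const_mul _) hi1]
          simp_rw [sub_mul]
  have hbound : ‖f T - ∫ u, f (T - u) * K u‖ ≤ κ * B + ε / (2 * (A + 1)) * A := by
    rw [hdiff, hA, hB, ← integral_const_mul, ← integral_const_mul,
      ← integral_add (hKm.const_mul _) (hKi.norm.const_mul _)]
    refine norm_integral_le_of_norm_le ((hKm.const_mul _).add (hKi.norm.const_mul _))
      (.of_forall fun u => ?_)
    rw [norm_mul]
    refine (mul_le_mul_of_nonneg_right (h2 u) (norm_nonneg _)).trans (le_of_eq ?_)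
    ring
  have h3 : ε / (2 * (A + 1)) * A ≤ ε / 2 := by
    rw [div_mul_eq_mul_div, div_le_div_iff₀ (by positivity) (by positivity)]
    nlinarith
  rw [hset] at h1
  have h4 : ‖f T‖ ≤ ‖f T - ∫ u, f (T - u) * K u‖ + ‖∫ u, f (T - u) * K u‖ := by
    simpa using norm_add_le (f T - ∫ u, f (T - u) * K u) (∫ u, f (T - u) * K u)
  nlinarith

/-- A Tauberian theorem: a bounded slowly oscillating function whose Laplace transform extends
continuously to the closed half plane tends to zero. -/
theorem tendsto_zero_of_continuousOn_laplace {f : ℝ → ℂ} {M : ℝ} {g : ℂ → ℂ}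
    (hf : Measurable f) (hM : ∀ t, ‖f t‖ ≤ M) (hf0 : ∀ t ≤ 0, f t = 0)
    (hosc : ∀ ε > 0, ∀ᶠ T in atTop, ∀ v, ‖f T - f (T - v)‖ ≤ |v| + ε)
    (hgc : ContinuousOn g {s | 0 ≤ s.re})
    (hg : ∀ s : ℂ, 0 < s.re → ∫ t in Set.Ioi (0 : ℝ), f t * Complex.exp (-s * t) = g s) :
    Tendsto f atTop (nhds 0) := by
  obtain ⟨C, hC, H⟩ := exists_forall_eventually_norm_le_of_laplace
  rw [Metric.tendsto_nhds]
  intro ε hε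
  set l : ℝ := 4 * C / ε with hl
  have hl0 : 0 < l := by positivity
  have := H (fun t => f (t / l)) M (1 / l) (fun s => l * g (l * s)) (by fun_prop)
    (fun t => hM _) (fun t ht => hf0 _ (div_nonpos_of_nonpos_of_nonneg ht hl0.le)) ?_ ?_ ?_
    (ε / 2) (by positivity)
  · have h2 := (tendsto_id.const_mul_atTop hl0).eventually this
    filter_upwards [h2] with T hT
    simp only [id_eq, mul_div_cancel_left₀ _ hl0.ne'] at hT
    rw [dist_zero_right]
    refine hT.trans_lt ?_
    have : 1 / l * C = ε / 4 := by rw [hl]; field_simp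
    linarith
  · intro δ hδ
    filter_upwards [(tendsto_id.atTop_div_const hl0).eventually (hosc δ hδ)] with T hT v
    have := hT (v / l)
    rw [abs_div, abs_of_pos hl0] at this
    simp only [id_eq, sub_div] at this ⊢
    calc _ ≤ _ := this
      _ = _ := by ring
  · refine continuousOn_const.mul (hgc.comp (by fun_prop) fun s hs => ?_)
    have hs' : 0 ≤ s.re := hs
    simpa using mul_nonneg hl0.le hs'
  · intro s hs
    rw [← hg (l * s) (by simpa using mul_pos hl0 hs)]
    have h := integral_comp_mul_left_Ioi (fun t => f (t / l) * Complex.exp (-s * t)) 0 hl0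
    simp only [mul_zero, mul_div_cancel_left₀ _ hl0.ne'] at h
    rw [show (∫ t in Set.Ioi (0 : ℝ), f t * Complex.exp (-(l * s) * t)) =
      ∫ x in Set.Ioi (0 : ℝ), f x * Complex.exp (-s * ↑(l * x)) from ?_, h]
    · rw [Complex.real_smul, ← mul_assoc]
      push_cast
      rw [mul_inv_cancel₀ (by exact_mod_cast hl0.ne'), one_mul]
    · refine integral_congr_ae (.of_forall fun t => ?_)
      simp only
      congr 2
      push_cast; ring

end Tauberian

section Convolution

open ArithmeticFunction Finset

lemma sum_Ioc_inv_sqrt_le (D : ℕ) : ∑ d ∈ Ioc 0 D, 1 / √(d : ℝ) ≤ 2 * √(D : ℝ) := by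
  induction D with
  | zero => simp
  | succ D ih =>
    rw [Finset.sum_Ioc_succ_top (Nat.zero_le D)]
    have h1 : 0 < √((D + 1 : ℕ) : ℝ) := by positivity
    have h2 : 0 ≤ √(D : ℝ) := by positivity
    have e1 : √((D + 1 : ℕ) : ℝ) ^ 2 = D + 1 := by rw [Real.sq_sqrt (by positivity)]; push_cast; ring
    have e2 : √(D : ℝ) ^ 2 = D := Real.sq_sqrt (by positivity)
    have : 1 / √((D + 1 : ℕ) : ℝ) ≤ 2 * √((D + 1 : ℕ) : ℝ) - 2 * √(D : ℝ) := by
      rw [div_le_iff₀ h1]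
      nlinarith [sq_nonneg (√((D + 1 : ℕ) : ℝ) - √(D : ℝ))]
    linarith

lemma sum_Ioc_inv_mul_inv_sqrt_div_le {C : ℝ} (hC : 0 ≤ C) {N D : ℕ} (hDN : D ≤ N) :
    ∑ d ∈ Ioc 0 D, 1 / (d : ℝ) * (C / √((N / d : ℕ) : ℝ)) ≤ 4 * C * √(D : ℝ) / √(N : ℝ) := by
  have hterm (d : ℕ) (hd : d ∈ Ioc 0 D) :
      1 / (d : ℝ) * (C / √((N / d : ℕ) : ℝ)) ≤ 2 * C / √(N : ℝ) * (1 / √(d : ℝ)) := by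
    obtain ⟨hd0, hdD⟩ := mem_Ioc.1 hd
    have hm : 1 ≤ N / d := (Nat.one_le_div_iff hd0).2 (hdD.trans hDN)
    have hN : 0 < N := hd0.trans_le (hdD.trans hDN)
    have hle : N ≤ 4 * ((N / d) * d) := by
      have h1 := Nat.div_add_mod N d
      have h2 := Nat.mod_lt N hd0
      nlinarith
    have hd' : (0 : ℝ) < √(d : ℝ) := by positivity
    have hN' : (0 : ℝ) < √(N : ℝ) := by positivity
    have hm' : (0 : ℝ) < √((N / d : ℕ) : ℝ) := Real.sqrt_pos.2 (by exact_mod_cast hm)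
    have hs : √(N : ℝ) ≤ 2 * (√((N / d : ℕ) : ℝ) * √(d : ℝ)) := by
      rw [← Real.sqrt_mul (by positivity)]
      calc √(N : ℝ) ≤ √(2 ^ 2 * (((N / d : ℕ) : ℝ) * d)) := by
            apply Real.sqrt_le_sqrt
            norm_num
            exact_mod_cast hle
        _ = _ := by rw [Real.sqrt_mul (by positivity), Real.sqrt_sq (by norm_num)]
    have hdd : (d : ℝ) = √(d : ℝ) * √(d : ℝ) := (Real.mul_self_sqrt (by positivity)).symm
    calc 1 / (d : ℝ) * (C / √((N / d : ℕ) : ℝ))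
        = C * √(N : ℝ) / (√(d : ℝ) * √(d : ℝ) * √((N / d : ℕ) : ℝ) * √(N : ℝ)) := by
          rw [← hdd]; field_simp
      _ ≤ C * (2 * (√((N / d : ℕ) : ℝ) * √(d : ℝ))) /
          (√(d : ℝ) * √(d : ℝ) * √((N / d : ℕ) : ℝ) * √(N : ℝ)) := by gcongr
      _ = _ := by field_simp
  calc _ ≤ ∑ d ∈ Ioc 0 D, 2 * C / √(N : ℝ) * (1 / √(d : ℝ)) := sum_le_sum hterm
    _ = 2 * C / √(N : ℝ) * ∑ d ∈ Ioc 0 D, 1 / √(d : ℝ) := by rw [mul_sum]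
    _ ≤ 2 * C / √(N : ℝ) * (2 * √(D : ℝ)) := by
        gcongr; exact sum_Ioc_inv_sqrt_le D
    _ = _ := by ring

lemma abs_sum_mul_le_of_inv_sqrt {α E : ℕ → ℝ} {C : ℝ} (hC : 0 ≤ C)
    (hα : ∀ n, |α n| ≤ 1 / n) (hE : ∀ m ≥ 1, |E m| ≤ C / √(m : ℝ)) {N D : ℕ} (hDN : D ≤ N) :
    |∑ d ∈ Ioc 0 D, α d * E (N / d)| ≤ 4 * C * √(D : ℝ) / √(N : ℝ) := by
  refine (abs_sum_le_sum_abs _ _).trans ((sum_le_sum fun d hd => ?_).trans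
    (sum_Ioc_inv_mul_inv_sqrt_div_le hC hDN))
  obtain ⟨hd0, hdD⟩ := mem_Ioc.1 hd
  rw [abs_mul]
  exact mul_le_mul (hα d) (hE _ ((Nat.one_le_div_iff hd0).2 (hdD.trans hDN))) (abs_nonneg _)
    (by positivity)

lemma sum_Ioc_mul_eq_add_sum_error (α β : ArithmeticFunction ℝ) (B : ℝ) (N : ℕ) :
    ∑ n ∈ Ioc 0 N, (α * β) n = (∑ n ∈ Ioc 0 N, α n) * B +
      ∑ d ∈ Ioc 0 N, α d * (∑ m ∈ Ioc 0 (N / d), β m - B) := by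
  rw [sum_Ioc_mul_eq_sum_sum, sum_mul, ← sum_add_distrib]
  exact sum_congr rfl fun d _ => by ring

/-- Partial sums of a Dirichlet convolution converge to the product of the limits, when one factor
is `O(1/n)` and the partial sums of the other converge at the rate `O(n^(-1/2))`. -/
theorem tendsto_sum_mul_of_inv_sqrt {α β : ArithmeticFunction ℝ} {c B C : ℝ}
    (hα : ∀ n, |α n| ≤ 1 / n)
    (hA : Tendsto (fun N => ∑ n ∈ Ioc 0 N, α n) atTop (nhds c))
    (hB : ∀ m ≥ 1, |∑ n ∈ Ioc 0 m, β n - B| ≤ C / √(m : ℝ)) :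
    Tendsto (fun N => ∑ n ∈ Ioc 0 N, (α * β) n) atTop (nhds (c * B)) := by
  have hC : 0 ≤ C := by simpa using (abs_nonneg _).trans (hB 1 le_rfl)
  set E : ℕ → ℝ := fun m => ∑ n ∈ Ioc 0 m, β n - B with hE
  have hlarge (k : ℕ) (hk : 1 ≤ k) :
      Tendsto (fun N => ∑ d ∈ Ioc (N / k) N, α d * E (N / d)) atTop (nhds 0) := by
    induction k, hk using Nat.le_induction with
    | base => simp
    | succ k hk ih =>
      have hdiv (j : ℕ) (hj : 1 ≤ j) : Tendsto (fun N : ℕ => N / j) atTop atTop :=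
        Nat.tendsto_div_const_atTop (by lia)
      have h1 : Tendsto (fun N => (∑ n ∈ Ioc 0 (N / k), α n - ∑ n ∈ Ioc 0 (N / (k + 1)), α n) * E k)
          atTop (nhds 0) := by
        simpa using ((hA.comp (hdiv k hk)).sub (hA.comp (hdiv (k + 1) (by lia)))).mul_const (E k)
      have h2 := h1.add ih
      rw [add_zero] at h2
      refine h2.congr fun N => ?_
      have hle : N / (k + 1) ≤ N / k := Nat.div_le_div_left (by lia) (by lia)
      rw [← sum_Ioc_consecutive _ hle (Nat.div_le_self N k)]
      congr 1
      rw [← sum_Ioc_consecutive (fun n => α n) (Nat.zero_le _) hle, add_sub_cancel_left, sum_mul]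
      refine sum_congr rfl fun d hd => ?_
      obtain ⟨hd1, hd2⟩ := mem_Ioc.1 hd
      have hd0 : 0 < d := by lia
      have : N / d = k := by
        rw [Nat.div_lt_iff_lt_mul (by lia)] at hd1
        rw [Nat.le_div_iff_mul_le (by lia)] at hd2
        rw [Nat.div_eq_iff hd0]
        have e1 : d * (k + 1) = k * d + d := by ring
        have e2 : d * k = k * d := mul_comm d k
        constructor <;> omega
      rw [this]
  have herr : Tendsto (fun N => ∑ d ∈ Ioc 0 N, α d * E (N / d)) atTop (nhds 0) := by
    rw [Metric.tendsto_nhds]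
    intro ε hε
    have hk : Tendsto (fun k : ℕ => 4 * C / √(k : ℝ)) atTop (nhds 0) :=
      Tendsto.const_div_atTop (Real.tendsto_sqrt_atTop.comp tendsto_natCast_atTop_atTop) _
    obtain ⟨k, hk1, hk2⟩ := ((hk.eventually (gt_mem_nhds (half_pos hε))).and
      (eventually_ge_atTop 1)).exists
    filter_upwards [(Metric.tendsto_nhds.1 (hlarge k hk2)) (ε / 2) (by positivity),
      eventually_ge_atTop 1] with N hN hN1
    rw [dist_zero_right, Real.norm_eq_abs] at hN ⊢
    rw [← sum_Ioc_consecutive _ (Nat.zero_le _) (Nat.div_le_self N k)]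
    have hsmall := abs_sum_mul_le_of_inv_sqrt (α := α) (E := E) hC hα hB (Nat.div_le_self N k)
    have h3 : 4 * C * √((N / k : ℕ) : ℝ) / √(N : ℝ) ≤ 4 * C / √(k : ℝ) := by
      have hN0 : (0 : ℝ) < √(N : ℝ) := Real.sqrt_pos.2 (by exact_mod_cast hN1)
      have hk0 : (0 : ℝ) < √(k : ℝ) := Real.sqrt_pos.2 (by exact_mod_cast hk2)
      rw [div_le_div_iff₀ hN0 hk0, mul_assoc (4 * C), ← Real.sqrt_mul (by positivity)]
      gcongr
      exact_mod_cast Nat.div_mul_le_self N k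
    exact (abs_add_le _ _).trans_lt (by linarith)
  have := (hA.mul_const B).add herr
  rw [add_zero] at this
  exact this.congr fun N => (sum_Ioc_mul_eq_add_sum_error α β B N).symm

end Convolution

section CharacterSums

open Finset

lemma abs_sum_range_mul_sub_le {c g : ℕ → ℝ} {K : ℝ}
    (hc : ∀ n, |∑ i ∈ range n, c i| ≤ K) (hg : Antitone g) (n : ℕ) :
    |∑ i ∈ range (n + 1), c i * g i - (∑ i ∈ range (n + 1), c i) * g n| ≤ K * (g 0 - g n) := by
  induction n with
  | zero => simp
  | succ n ih =>
    rw [sum_range_succ, sum_range_succ (fun i => c i) (n + 1)]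
    set P := ∑ i ∈ range (n + 1), c i with hP
    have h1 : |P * (g n - g (n + 1))| ≤ K * (g n - g (n + 1)) := by
      have h2 : 0 ≤ g n - g (n + 1) := sub_nonneg.2 (hg (Nat.le_succ n))
      rw [abs_mul, abs_of_nonneg h2]
      exact mul_le_mul_of_nonneg_right (hc _) h2
    calc _ = |(∑ i ∈ range (n + 1), c i * g i - P * g n) + P * (g n - g (n + 1))| := by
          congr 1; ring
      _ ≤ _ := (abs_add_le _ _).trans (add_le_add ih h1)
      _ = _ := by ring

/-- Abel's inequality. -/
lemma abs_sum_range_mul_le {c g : ℕ → ℝ} {K : ℝ} (hc : ∀ n, |∑ i ∈ range n, c i| ≤ K)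
    (hg : Antitone g) (hg0 : ∀ n, 0 ≤ g n) (n : ℕ) : |∑ i ∈ range n, c i * g i| ≤ K * g 0 := by
  have hK : 0 ≤ K := by simpa using hc 0
  cases n with
  | zero => simpa using mul_nonneg hK (hg0 0)
  | succ n =>
    have h1 := abs_sum_range_mul_sub_le hc hg n
    have h2 : |(∑ i ∈ range (n + 1), c i) * g n| ≤ K * g n := by
      rw [abs_mul, abs_of_nonneg (hg0 n)]
      exact mul_le_mul_of_nonneg_right (hc _) (hg0 n)
    have h3 := abs_add_le (∑ i ∈ range (n + 1), c i * g i - (∑ i ∈ range (n + 1), c i) * g n)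
      ((∑ i ∈ range (n + 1), c i) * g n)
    rw [sub_add_cancel] at h3
    linarith

lemma sum_Ioc_zero_add (f : ℕ → ℝ) (a n : ℕ) :
    ∑ i ∈ Ioc 0 (a + n), f i = ∑ i ∈ Ioc 0 a, f i + ∑ i ∈ range n, f (a + 1 + i) := by
  induction n with
  | zero => simp
  | succ n ih =>
    rw [← add_assoc, Finset.sum_Ioc_succ_top (Nat.zero_le _), ih, sum_range_succ, add_assoc]
    congr 3; ring

/-- Tail estimate from Abel's inequality. -/
lemma abs_sum_Ioc_sub_sum_Ioc_le {c g : ℕ → ℝ} {K : ℝ} {n₀ : ℕ}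
    (hc : ∀ a n, |∑ i ∈ range n, c (a + i)| ≤ K) (hg : ∀ m n, n₀ ≤ m → m ≤ n → g n ≤ g m)
    (hg0 : ∀ n, 0 ≤ g n) {a b : ℕ} (ha : n₀ ≤ a + 1) (hab : a ≤ b) :
    |∑ i ∈ Ioc 0 b, c i * g i - ∑ i ∈ Ioc 0 a, c i * g i| ≤ K * g (a + 1) := by
  obtain ⟨n, rfl⟩ := Nat.exists_eq_add_of_le hab
  rw [sum_Ioc_zero_add, add_sub_cancel_left]
  simpa using abs_sum_range_mul_le (c := fun i => c (a + 1 + i)) (g := fun i => g (a + 1 + i))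
    (hc (a + 1)) (fun i j hij => hg _ _ (by lia) (by lia)) (fun _ => hg0 _) n

/-- A quantitative Dirichlet test. -/
lemma exists_abs_sum_Ioc_sub_le_inv_sqrt {c g : ℕ → ℝ} {K G : ℝ} {n₀ : ℕ}
    (hc : ∀ a n, |∑ i ∈ range n, c (a + i)| ≤ K) (hg : ∀ m n, n₀ ≤ m → m ≤ n → g n ≤ g m)
    (hg0 : ∀ n, 0 ≤ g n) (hgG : ∀ n, g n ≤ G / √(n : ℝ)) :
    ∃ B C : ℝ, ∀ m ≥ 1, |∑ i ∈ Ioc 0 m, c i * g i - B| ≤ C / √(m : ℝ) := by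
  have hK : 0 ≤ K := by simpa using hc 0 0
  have hG : 0 ≤ G := by simpa using (hg0 1).trans (hgG 1)
  set S : ℕ → ℝ := fun m => ∑ i ∈ Ioc 0 m, c i * g i with hS
  have htail {a b : ℕ} (ha1 : 1 ≤ a) (ha : n₀ ≤ a) (hab : a ≤ b) :
      |S b - S a| ≤ K * G / √(a : ℝ) := by
    refine (abs_sum_Ioc_sub_sum_Ioc_le hc hg hg0 (by lia) hab).trans ?_
    rw [mul_div_assoc]
    refine mul_le_mul_of_nonneg_left ((hgG _).trans ?_) hK
    have : (0 : ℝ) < √(a : ℝ) := Real.sqrt_pos.2 (by exact_mod_cast ha1)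
    gcongr
    lia
  have hto : Tendsto (fun a : ℕ => K * G / √(a : ℝ)) atTop (nhds 0) :=
    Tendsto.const_div_atTop (Real.tendsto_sqrt_atTop.comp tendsto_natCast_atTop_atTop) _
  have hcau : CauchySeq S := by
    rw [Metric.cauchySeq_iff']
    intro ε hε
    obtain ⟨a, ha, ha1, ha2⟩ := ((hto.eventually (gt_mem_nhds hε)).and
      ((eventually_ge_atTop 1).and (eventually_ge_atTop n₀))).exists
    refine ⟨a, fun b hb => ?_⟩
    rw [Real.dist_eq]
    exact (htail ha1 ha2 hb).trans_lt ha
  obtain ⟨B, hB⟩ := cauchySeq_tendsto_of_complete hcau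
  refine ⟨B, K * G + ∑ i ∈ range n₀, |S i - B| * √(i : ℝ), fun m hm => ?_⟩
  have hm0 : (0 : ℝ) < √(m : ℝ) := Real.sqrt_pos.2 (by exact_mod_cast hm)
  have hsum : 0 ≤ ∑ i ∈ range n₀, |S i - B| * √(i : ℝ) := sum_nonneg fun _ _ => by positivity
  rcases le_or_gt n₀ m with h | h
  · have h1 : |B - S m| ≤ K * G / √(m : ℝ) := by
      refine le_of_tendsto (hB.sub_const (S m)).abs ?_
      filter_upwards [eventually_ge_atTop m] with b hb using htail hm h hb
    rw [abs_sub_comm] at h1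
    refine h1.trans ?_
    gcongr
    linarith
  · rw [le_div_iff₀ hm0]
    have h1 := single_le_sum (f := fun i : ℕ => |S i - B| * √(i : ℝ))
      (fun i _ => by positivity) (mem_range.2 h)
    have h2 : 0 ≤ K * G := mul_nonneg hK hG
    linarith

lemma log_div_self_le_two_div_sqrt (n : ℕ) : Real.log n / n ≤ 2 / √(n : ℝ) := by
  rcases Nat.eq_zero_or_pos n with rfl | hn
  · simp
  have hs : (0 : ℝ) < √(n : ℝ) := Real.sqrt_pos.2 (by exact_mod_cast hn)
  have hn' : (n : ℝ) = √(n : ℝ) * √(n : ℝ) := (Real.mul_self_sqrt (by positivity)).symm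
  have h1 : Real.log n = 2 * Real.log (√(n : ℝ)) := by
    rw [Real.log_sqrt (by positivity)]; ring
  have h2 := Real.log_le_sub_one_of_pos hs
  rw [div_le_div_iff₀ (by exact_mod_cast hn) hs, h1]
  nlinarith

variable {N : ℕ} {ψ : DirichletCharacter ℂ N} {r : ℕ → ℝ}

lemma abs_le_one_of_character (hr : ∀ n : ℕ, ψ n = r n) (n : ℕ) : |r n| ≤ 1 := by
  have := ψ.norm_le_one (n : ZMod N)
  rwa [hr, Complex.norm_real, Real.norm_eq_abs] at this

variable [NeZero N]

lemma sum_range_level_eq_zero (hψ : ψ ≠ 1) (hr : ∀ n : ℕ, ψ n = r n) :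
    ∑ i ∈ range N, r i = 0 := by
  have h1 : ∑ i ∈ range N, ψ (i : ZMod N) = ∑ a : ZMod N, ψ a := by
    refine sum_nbij' (fun n => (n : ZMod N)) ZMod.val (by simp) ?_ ?_ ?_ (by simp)
    · intro a _; simpa using ZMod.val_lt a
    · intro n hn; exact ZMod.val_cast_of_lt (by simpa using hn)
    · intro a _; simp
  rw [MulChar.sum_eq_zero_of_ne_one hψ] at h1
  simp_rw [hr] at h1
  exact_mod_cast h1

lemma abs_sum_range_character_le (hψ : ψ ≠ 1) (hr : ∀ n : ℕ, ψ n = r n) (n : ℕ) :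
    |∑ i ∈ range n, r i| ≤ N := by
  induction n using Nat.strong_induction_on with
  | _ n ih =>
    rcases lt_or_ge n N with h | h
    · refine (abs_sum_le_sum_abs _ _).trans ((sum_le_sum fun i _ =>
        abs_le_one_of_character hr i).trans ?_)
      simpa using h.le
    · obtain ⟨m, rfl⟩ := Nat.exists_eq_add_of_le h
      have hper (i : ℕ) : r (N + i) = r i := by
        have h1 := hr (N + i)
        push_cast at h1
        rw [ZMod.natCast_self, zero_add, hr] at h1
        exact_mod_cast h1.symm
      rw [sum_range_add, sum_range_level_eq_zero hψ hr, zero_add]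
      simp_rw [hper]
      exact ih m (by have := NeZero.pos N; lia)

lemma abs_sum_range_shift_character_le (hψ : ψ ≠ 1) (hr : ∀ n : ℕ, ψ n = r n) (a n : ℕ) :
    |∑ i ∈ range n, r (a + i)| ≤ 2 * N := by
  have h1 := sum_range_add r a n
  have h2 := abs_sum_range_character_le hψ hr (a + n)
  have h3 := abs_sum_range_character_le hψ hr a
  rw [abs_le] at *
  constructor <;> linarith

lemma exists_abs_sum_character_div_sub_le (hψ : ψ ≠ 1) (hr : ∀ n : ℕ, ψ n = r n) :
    ∃ L C : ℝ, ∀ m ≥ 1, |∑ i ∈ Ioc 0 m, r i * (1 / i) - L| ≤ C / √(m : ℝ) := by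
  refine exists_abs_sum_Ioc_sub_le_inv_sqrt (g := fun i => 1 / i) (G := 1) (n₀ := 1)
    (abs_sum_range_shift_character_le hψ hr) (fun m n hm hmn => ?_) (fun _ => by positivity)
    fun n => ?_
  · have : (0 : ℝ) < m := by exact_mod_cast hm
    gcongr
  · rcases Nat.eq_zero_or_pos n with rfl | hn
    · simp
    · have : (1 : ℝ) ≤ n := by exact_mod_cast hn
      refine one_div_le_one_div_of_le (Real.sqrt_pos.2 (by linarith)) ?_
      rw [Real.sqrt_le_left (by linarith)]
      nlinarith

lemma exists_abs_sum_character_mul_log_div_sub_le (hψ : ψ ≠ 1) (hr : ∀ n : ℕ, ψ n = r n) :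
    ∃ B C : ℝ, ∀ m ≥ 1, |∑ i ∈ Ioc 0 m, r i * (Real.log i / i) - B| ≤ C / √(m : ℝ) := by
  refine exists_abs_sum_Ioc_sub_le_inv_sqrt (g := fun i => Real.log i / i) (G := 2) (n₀ := 3)
    (abs_sum_range_shift_character_le hψ hr) (fun m n hm hmn => ?_) (fun n => ?_)
    log_div_self_le_two_div_sqrt
  · have h3 : Real.exp 1 ≤ 3 := Real.exp_one_lt_d9.le.trans (by norm_num)
    have hm' : (3 : ℝ) ≤ m := by exact_mod_cast hm
    have hmn' : (m : ℝ) ≤ n := by exact_mod_cast hmn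
    exact Real.log_div_self_antitoneOn (h3.trans hm') (h3.trans (hm'.trans hmn')) hmn'
  · exact div_nonneg (Real.log_natCast_nonneg n) (Nat.cast_nonneg n)

/-- The limit of the partial sums of `∑ χ(n)/n` is the value of the `L`-function at `1`. -/
lemma LFunction_one_eq_of_tendsto (hψ : ψ ≠ 1) (hr : ∀ n : ℕ, ψ n = r n) {L : ℝ}
    (hL : Tendsto (fun m => ∑ i ∈ Ioc 0 m, r i * (1 / i)) atTop (nhds L)) :
    DirichletCharacter.LFunction ψ 1 = L := by
  have hfin (m : ℕ) (s : ℝ) (hs : 1 < s) :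
      ‖DirichletCharacter.LFunction ψ s - (∑ i ∈ Ioc 0 m, r i * (i : ℝ) ^ (-s) : ℝ)‖ ≤
        2 * N * (1 / ((m + 1 : ℕ) : ℝ)) := by
    have hs' : 1 < (s : ℂ).re := by simpa using hs
    have hsum := (ψ.LSeriesSummable_of_one_lt_re hs').hasSum.tendsto_sum_nat
    have heq (b : ℕ) : ∑ i ∈ range (b + 1), LSeries.term (fun n => ψ n) s i =
        (∑ i ∈ Ioc 0 b, r i * (i : ℝ) ^ (-s) : ℝ) := by
      rw [range_eq_Ico, sum_eq_sum_Ico_succ_bot (Nat.succ_pos b), LSeries.term_zero, zero_add]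
      push_cast
      refine sum_congr (by ext; simp; lia) fun i hi => ?_
      have hi0 : i ≠ 0 := by simp at hi; lia
      rw [LSeries.term_of_ne_zero hi0, hr, Complex.ofReal_cpow (by positivity),
        div_eq_mul_inv, ← Complex.cpow_neg]
      push_cast
      rfl
    have hto := (hsum.comp (tendsto_add_atTop_nat 1)).congr heq
    rw [show ∑' i, LSeries.term (fun n => ψ n) s i = LSeries (fun n => ψ n) s from rfl,
      ← DirichletCharacter.LFunction_eq_LSeries ψ hs'] at hto
    refine le_of_tendsto (hto.sub_const _).norm ?_
    filter_upwards [eventually_ge_atTop m] with b hb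
    rw [← Complex.ofReal_sub, Complex.norm_real, Real.norm_eq_abs]
    refine (abs_sum_Ioc_sub_sum_Ioc_le (n₀ := 1) (g := fun i : ℕ => (i : ℝ) ^ (-s))
      (abs_sum_range_shift_character_le hψ hr) (fun a b ha hab => ?_) (fun _ => by positivity)
      (by lia) hb).trans ?_
    · exact Real.rpow_le_rpow_of_nonpos (by exact_mod_cast ha) (by exact_mod_cast hab)
        (by linarith)
    · refine mul_le_mul_of_nonneg_left ?_ (by positivity)
      rw [Real.rpow_neg (by positivity), one_div]
      refine inv_anti₀ (by positivity) ?_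
      exact Real.self_le_rpow_of_one_le (by push_cast; linarith [Nat.cast_nonneg (α := ℝ) m]) hs.le
  have hone (m : ℕ) : ‖DirichletCharacter.LFunction ψ 1 - (∑ i ∈ Ioc 0 m, r i * (1 / i) : ℝ)‖ ≤
      2 * N * (1 / ((m + 1 : ℕ) : ℝ)) := by
    have hc : ContinuousAt (fun s : ℝ => DirichletCharacter.LFunction ψ s -
        (∑ i ∈ Ioc 0 m, r i * (i : ℝ) ^ (-s) : ℝ)) 1 := by
      have h1 : Continuous fun s : ℝ => DirichletCharacter.LFunction ψ s :=
        (DirichletCharacter.differentiable_LFunction hψ).continuous.comp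
          Complex.continuous_ofReal
      refine h1.continuousAt.sub (Complex.continuous_ofReal.continuousAt.comp ?_)
      refine tendsto_finsetSum _ fun i hi => ?_
      have hi0 : (i : ℝ) ≠ 0 := by simp at hi; exact_mod_cast (by lia : i ≠ 0)
      exact (continuousAt_const.mul ((Real.continuousAt_const_rpow hi0).comp
        continuousAt_neg)).tendsto
    have := le_of_tendsto (hc.norm.tendsto.mono_left (nhdsWithin_le_nhds (s := Set.Ioi 1)))
      (eventually_nhdsWithin_of_forall fun s hs => hfin m s hs)
    simpa [Real.rpow_neg_one] using this
  have h0 : Tendsto (fun m : ℕ => 2 * (N : ℝ) * (1 / ((m + 1 : ℕ) : ℝ))) atTop (nhds 0) := by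
    simpa using tendsto_one_div_add_atTop_nhds_zero_nat.const_mul (2 * (N : ℝ))
  have h2 := tendsto_zero_iff_norm_tendsto_zero.2 (squeeze_zero (fun _ => norm_nonneg _) hone h0)
  have h3 := (Complex.continuous_ofReal.tendsto L).comp hL
  have h4 := tendsto_nhds_unique h2 (h3.const_sub (DirichletCharacter.LFunction ψ 1))
  exact (sub_eq_zero.1 h4.symm)

end CharacterSums

section DirichletTauberian

open Finset

lemma abs_sum_Ioc_le_log_sub_log {α : ℕ → ℝ} (hα : ∀ n, |α n| ≤ 1 / n) {m k : ℕ} (hm : 1 ≤ m)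
    (hmk : m ≤ k) : |∑ n ∈ Ioc m k, α n| ≤ Real.log k - Real.log m := by
  induction k, hmk using Nat.le_induction with
  | base => simp
  | succ k hk ih =>
    rw [Finset.sum_Ioc_succ_top hk]
    have hk0 : (0 : ℝ) < k := by exact_mod_cast hm.trans hk
    have h1 := Real.one_sub_inv_le_log_of_pos (x := ((k : ℝ) + 1) / k) (by positivity)
    rw [Real.log_div (by positivity) hk0.ne'] at h1
    have h2 : 1 - (((k : ℝ) + 1) / k)⁻¹ = 1 / ((k + 1 : ℕ) : ℝ) := by
      push_cast
      field_simp
      ring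
    have h3 := abs_add_le (∑ n ∈ Ioc m k, α n) (α (k + 1))
    have h4 := hα (k + 1)
    rw [← h2] at h4
    push_cast
    linarith

lemma abs_sum_floor_exp_sub_le {α : ℕ → ℝ} (hα : ∀ n, |α n| ≤ 1 / n) {a b : ℝ} (ha : 0 ≤ a)
    (hab : a ≤ b) :
    |∑ n ∈ Ioc 0 ⌊Real.exp b⌋₊, α n - ∑ n ∈ Ioc 0 ⌊Real.exp a⌋₊, α n| ≤
      (b - a) + 2 * Real.exp (-a) := by
  set m := ⌊Real.exp a⌋₊ with hm
  set k := ⌊Real.exp b⌋₊ with hk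
  have hm1 : 1 ≤ m := Nat.le_floor (by simpa using ha)
  have hmk : m ≤ k := Nat.floor_mono (Real.exp_le_exp.2 hab)
  have hm0 : (1 : ℝ) ≤ m := by exact_mod_cast hm1
  have hk0 : (0 : ℝ) < k := by exact_mod_cast hm1.trans hmk
  rw [← Finset.sum_Ioc_consecutive α (Nat.zero_le m) hmk, add_sub_cancel_left]
  refine (abs_sum_Ioc_le_log_sub_log hα hm1 hmk).trans ?_
  have h1 : Real.log k ≤ b := by
    rw [Real.log_le_iff_le_exp hk0]
    exact Nat.floor_le (Real.exp_pos b).le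
  have h2 : a ≤ Real.log (m + 1) := by
    rw [Real.le_log_iff_exp_le (by positivity)]
    exact (Nat.lt_floor_add_one _).le
  have h3 : Real.log (m + 1) ≤ Real.log m + 1 / m := by
    have := Real.log_le_sub_one_of_pos (x := ((m : ℝ) + 1) / m) (by positivity)
    rw [Real.log_div (by positivity) (by positivity)] at this
    have h5 : ((m : ℝ) + 1) / m - 1 = 1 / m := by field_simp; ring
    linarith
  have h4 : 1 / (m : ℝ) ≤ 2 * Real.exp (-a) := by
    rw [Real.exp_neg, ← div_eq_mul_inv, div_le_div_iff₀ (by positivity) (Real.exp_pos a)]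
    have := Nat.lt_floor_add_one (Real.exp a)
    rw [← hm] at this
    linarith
  linarith

lemma LSeries_eq_mul_integral_exp {α : ℕ → ℝ} {K : ℝ} (hα : ∀ n, |α n| ≤ 1 / n)
    (hK : ∀ N, |∑ n ∈ Ioc 0 N, α n| ≤ K) {s : ℂ} (hs : 0 < s.re) :
    LSeries (fun n => (α n : ℂ)) s = s * ∫ t in Set.Ioi (0 : ℝ),
      ((∑ n ∈ Ioc 0 ⌊Real.exp t⌋₊, α n : ℝ) : ℂ) * Complex.exp (-s * t) := by
  rw [LSeries_eq_mul_integral _ le_rfl hs]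
  · rw [← Real.exp_zero, ← MeasureTheory.integral_comp_exp_Ioi]
    congr 1
    refine MeasureTheory.integral_congr_ae (Eventually.of_forall fun t => ?_)
    have h1 : ((Real.exp t : ℝ) : ℂ) ≠ 0 := by exact_mod_cast (Real.exp_pos t).ne'
    have h2 : ((Real.exp t : ℝ) : ℂ) ^ (-(s + 1)) =
        Complex.exp (-s * t) * ((Real.exp t : ℝ) : ℂ)⁻¹ := by
      rw [neg_add, Complex.cpow_add _ _ h1, Complex.cpow_neg_one, Complex.cpow_def_of_ne_zero h1,
        ← Complex.ofReal_log (Real.exp_pos t).le, Real.log_exp]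
      congr 2
      ring
    simp only [h2, Complex.real_smul, Complex.ofReal_sum]
    rw [show Icc 1 ⌊Real.exp t⌋₊ = Ioc 0 ⌊Real.exp t⌋₊ from rfl]
    field_simp
  · refine LSeriesSummable_of_le_const_mul_rpow hs ⟨1, fun n hn => ?_⟩
    rw [Complex.norm_real, zero_sub, Real.rpow_neg_one, one_mul, ← one_div]
    exact hα n
  · refine Asymptotics.IsBigO.of_bound K (Eventually.of_forall fun n => ?_)
    simp only [Real.rpow_zero, norm_one, mul_one]
    rw [← Complex.ofReal_sum, Complex.norm_real]
    exact hK n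

/-- A Tauberian theorem for Dirichlet series with coefficients `O(1/n)` and bounded partial sums. -/
theorem tendsto_sum_of_LSeries_eq {α : ℕ → ℝ} {K c : ℝ} {F : ℂ → ℂ} {U : Set ℂ}
    (hα : ∀ n, |α n| ≤ 1 / n) (hK : ∀ N, |∑ n ∈ Ioc 0 N, α n| ≤ K) (hU : IsOpen U)
    (hUre : ∀ s : ℂ, 0 ≤ s.re → s ∈ U) (hF : DifferentiableOn ℂ F U) (hc : F 0 = c)
    (hLF : ∀ s : ℂ, 0 < s.re → LSeries (fun n => (α n : ℂ)) s = F s) :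
    Tendsto (fun N => ∑ n ∈ Ioc 0 N, α n) atTop (nhds c) := by
  set S : ℝ → ℝ := fun t => ∑ n ∈ Ioc 0 ⌊Real.exp t⌋₊, α n with hS
  have hSm : Measurable S :=
    (measurable_of_countable fun n : ℕ => ∑ i ∈ Ioc 0 n, α i).comp
      (Nat.measurable_floor.comp Real.measurable_exp)
  set f : ℝ → ℂ := fun t => if t ≤ 0 then 0 else ((S t - c : ℝ) : ℂ) with hf
  have hK0 : 0 ≤ K := (abs_nonneg _).trans (hK 0)
  have hfM (t : ℝ) : ‖f t‖ ≤ K + |c| := by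
    simp only [hf]
    split_ifs
    · simp only [norm_zero]; positivity
    · rw [Complex.norm_real]
      exact (norm_sub_le _ _).trans (add_le_add (hK _) le_rfl)
  have hfpos {t : ℝ} (ht : 0 < t) : f t = ((S t - c : ℝ) : ℂ) := if_neg ht.not_ge
  have key : Tendsto f atTop (nhds 0) := by
    refine tendsto_zero_of_continuousOn_laplace (M := K + |c|) (g := dslope F 0) ?_ hfM
      (fun t ht => if_pos ht) ?_ ?_ ?_
    · exact Measurable.ite measurableSet_Iic measurable_const
        (Complex.measurable_ofReal.comp (hSm.sub_const c))
    · intro ε hε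
      have h1 : Tendsto (fun T : ℝ => 2 * Real.exp (-(T / 2))) atTop (nhds 0) := by
        simpa using (Real.tendsto_exp_neg_atTop_nhds_zero.comp
          (tendsto_id.atTop_div_const (by norm_num : (0 : ℝ) < 2))).const_mul 2
      filter_upwards [h1.eventually (gt_mem_nhds hε), eventually_gt_atTop 0,
        eventually_ge_atTop (4 * (K + |c|))] with T hT hT0 hT4 v
      rcases le_or_gt |v| (T / 2) with hv | hv
      · obtain ⟨hv1, hv2⟩ := abs_le.1 hv
        rw [hfpos hT0, hfpos (by linarith), ← Complex.ofReal_sub, Complex.norm_real,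
          Real.norm_eq_abs, sub_sub_sub_cancel_right]
        have hmono {a : ℝ} (ha : T / 2 ≤ a) : 2 * Real.exp (-a) ≤ ε := by
          have : Real.exp (-a) ≤ Real.exp (-(T / 2)) := Real.exp_le_exp.2 (by linarith)
          linarith
        rcases le_total 0 v with h0 | h0
        · have := abs_sum_floor_exp_sub_le hα (a := T - v) (b := T) (by linarith) (by linarith)
          have h3 := hmono (a := T - v) (by linarith)
          rw [abs_of_nonneg h0]
          exact this.trans (by linarith)
        · have := abs_sum_floor_exp_sub_le hα (a := T) (b := T - v) (by linarith) (by linarith)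
          have h3 := hmono (a := T) (by linarith)
          rw [abs_sub_comm, abs_of_nonpos h0]
          exact this.trans (by linarith)
      · have := norm_sub_le (f T) (f (T - v))
        linarith [hfM T, hfM (T - v)]
    · refine ContinuousOn.mono ?_ hUre
      exact (continuousOn_dslope (hU.mem_nhds (hUre 0 (by simp)))).2
        ⟨hF.continuousOn, hF.differentiableAt (hU.mem_nhds (hUre 0 (by simp)))⟩
    · intro s hs
      have hs0 : s ≠ 0 := by rintro rfl; simp at hs
      have hs' : (-s).re < 0 := by simpa using hs
      have h_int := integrableOn_exp_mul_complex_Ioi hs' 0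
      have h_intS : MeasureTheory.IntegrableOn
          (fun t : ℝ => (S t : ℂ) * Complex.exp (-s * t)) (Set.Ioi 0) := by
        refine MeasureTheory.Integrable.bdd_mul (c := K) h_int
          (Complex.measurable_ofReal.comp hSm).aestronglyMeasurable
          (Eventually.of_forall fun t => ?_)
        rw [Complex.norm_real]
        exact hK _
      have h1 : ∫ t in Set.Ioi (0 : ℝ), f t * Complex.exp (-s * t) =
          ∫ t in Set.Ioi (0 : ℝ),
            ((S t : ℂ) * Complex.exp (-s * t) - (c : ℂ) * Complex.exp (-s * t)) := by
        refine MeasureTheory.setIntegral_congr_fun measurableSet_Ioi fun t ht => ?_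
        simp only [hfpos ht]
        push_cast
        ring
      rw [h1, MeasureTheory.integral_sub h_intS (h_int.const_mul _),
        MeasureTheory.integral_const_mul, integral_exp_mul_complex_Ioi hs' 0, dslope_of_ne _ hs0,
        slope_def_field, ← hLF s hs, hc, LSeries_eq_mul_integral_exp hα hK hs]
      simp only [Complex.ofReal_zero, mul_zero, Complex.exp_zero, sub_zero]
      field_simp
      ring
  have key2 : Tendsto (fun N : ℕ => f (Real.log N)) atTop (nhds 0) :=
    key.comp (Real.tendsto_log_atTop.comp tendsto_natCast_atTop_atTop)
  have key3 : Tendsto (fun N : ℕ => (∑ n ∈ Ioc 0 N, α n) - c) atTop (nhds 0) := by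
    refine (((Complex.continuous_re.tendsto 0).comp key2).congr' ?_)
    filter_upwards [eventually_ge_atTop 2] with N hN
    have hN' : (1 : ℝ) < N := by exact_mod_cast hN
    rw [Function.comp_apply, hfpos (Real.log_pos hN'), Complex.ofReal_re]
    simp only [hS]
    rw [Real.exp_log (by linarith), Nat.floor_natCast]
  simpa using key3.add_const c

end DirichletTauberian

section Twist

open Finset
open ArithmeticFunction hiding log
open scoped ArithmeticFunction.Moebius ArithmeticFunction.zeta

/-- The arithmetic function `n ↦ r(n) f(n) / n`. -/
noncomputable def twistDiv (r : ℕ → ℝ) (f : ArithmeticFunction ℝ) : ArithmeticFunction ℝ :=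
  ⟨fun n => r n * (f n / n), by simp⟩

lemma twistDiv_apply (r : ℕ → ℝ) (f : ArithmeticFunction ℝ) (n : ℕ) :
    twistDiv r f n = r n * (f n / n) := rfl

lemma twistDiv_mul {r : ℕ → ℝ} (hr : ∀ m n, r (m * n) = r m * r n) (f g : ArithmeticFunction ℝ) :
    twistDiv r (f * g) = twistDiv r f * twistDiv r g := by
  ext n
  simp only [twistDiv_apply, ArithmeticFunction.mul_apply, sum_div, mul_sum]
  refine sum_congr rfl fun x hx => ?_
  rw [← (Nat.mem_divisorsAntidiagonal.1 hx).1, hr]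
  push_cast
  ring

variable {N : ℕ} {ψ : DirichletCharacter ℂ N} {r : ℕ → ℝ}

lemma map_mul_of_character (hr : ∀ n : ℕ, ψ n = r n) (m n : ℕ) : r (m * n) = r m * r n := by
  have h := hr (m * n)
  rw [Nat.cast_mul, map_mul, hr, hr] at h
  exact_mod_cast h.symm

lemma map_one_of_character (hr : ∀ n : ℕ, ψ n = r n) : r 1 = 1 := by
  have h := hr 1
  rw [Nat.cast_one, map_one] at h
  exact_mod_cast h.symm

variable [NeZero N]

lemma LSeries_twistDiv_moebius (hr : ∀ n : ℕ, ψ n = r n) {s : ℂ} (hs : 0 < s.re) :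
    LSeries (fun n => (twistDiv r (μ : ArithmeticFunction ℝ) n : ℂ)) s =
      (DirichletCharacter.LFunction ψ (1 + s))⁻¹ := by
  have hs' : 1 < (1 + s).re := by simpa using hs
  have h1 := DirichletCharacter.LSeries.mul_mu_eq_one ψ hs'
  rw [← DirichletCharacter.LFunction_eq_LSeries ψ hs'] at h1
  rw [← eq_inv_of_mul_eq_one_right h1]
  refine tsum_congr fun n => ?_
  rcases eq_or_ne n 0 with rfl | hn
  · simp
  rw [LSeries.term_of_ne_zero hn, LSeries.term_of_ne_zero hn,
    Complex.cpow_add _ _ (Nat.cast_ne_zero.2 hn), Complex.cpow_one, twistDiv_apply, Pi.mul_apply, hr]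
  push_cast
  rw [ArithmeticFunction.intCoe_apply]
  push_cast
  rw [← mul_div_assoc, div_div]

/-- For a nontrivial real character `χ`, the series `∑ χ(n)/n`, `∑ χ(n) log n/n` and
`∑ χ(n) Λ(n)/n` converge, the third to the quotient of the other two. -/
theorem exists_tendsto_sum_character_mul_vonMangoldt_div (hψ : ψ ≠ 1) (hr : ∀ n : ℕ, ψ n = r n) :
    ∃ L B : ℝ, Tendsto (fun m => ∑ i ∈ Ioc 0 m, r i * (1 / i)) atTop (nhds L) ∧
      Tendsto (fun m => ∑ i ∈ Ioc 0 m, r i * (Real.log i / i)) atTop (nhds B) ∧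
      Tendsto (fun m => ∑ i ∈ Ioc 0 m, r i * (Λ i / i)) atTop (nhds (B / L)) := by
  obtain ⟨L, C, hL⟩ := exists_abs_sum_character_div_sub_le hψ hr
  obtain ⟨B, C', hB⟩ := exists_abs_sum_character_mul_log_div_sub_le hψ hr
  have hlim {u : ℕ → ℝ} {l C : ℝ} (h : ∀ m : ℕ, 1 ≤ m → |u m - l| ≤ C / √(m : ℝ)) :
      Tendsto u atTop (nhds l) := by
    rw [tendsto_iff_norm_sub_tendsto_zero]
    refine squeeze_zero' (Eventually.of_forall fun _ => norm_nonneg _)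
      ((eventually_ge_atTop 1).mono fun m hm => h m hm) ?_
    exact (Real.tendsto_sqrt_atTop.comp tendsto_natCast_atTop_atTop).const_div_atTop C
  have hLt := hlim hL
  have hLF := LFunction_one_eq_of_tendsto hψ hr hLt
  have hL0 : L ≠ 0 := by
    have := DirichletCharacter.LFunction_apply_one_ne_zero hψ
    rw [hLF] at this
    exact_mod_cast this
  have hmul := map_mul_of_character hr
  set α := twistDiv r (μ : ArithmeticFunction ℝ) with hα
  have hα1 (n : ℕ) : |α n| ≤ 1 / n := by
    have h1 : |((μ n : ℤ) : ℝ)| ≤ 1 := by exact_mod_cast abs_moebius_le_one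
    rw [hα, twistDiv_apply, ArithmeticFunction.intCoe_apply, abs_mul, abs_div, Nat.abs_cast]
    calc _ ≤ 1 * (1 / (n : ℝ)) := by
          gcongr
          exact abs_le_one_of_character hr n
      _ = _ := one_mul _
  have hζ : ∀ m ≥ 1, |∑ n ∈ Ioc 0 m, twistDiv r (ζ : ArithmeticFunction ℝ) n - L| ≤
      C / √(m : ℝ) := by
    intro m hm
    rw [sum_congr rfl fun n hn => ?_]
    · exact hL m hm
    · have hn0 : n ≠ 0 := by simp at hn; lia
      simp [twistDiv_apply, ArithmeticFunction.natCoe_apply, ArithmeticFunction.zeta_apply, hn0]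
  have hlog : ∀ m ≥ 1, |∑ n ∈ Ioc 0 m, twistDiv r ArithmeticFunction.log n - B| ≤
      C' / √(m : ℝ) := hB
  have hone : α * twistDiv r (ζ : ArithmeticFunction ℝ) = 1 := by
    rw [hα, ← twistDiv_mul hmul, ArithmeticFunction.coe_moebius_mul_coe_zeta]
    ext n
    rcases eq_or_ne n 1 with rfl | hn
    · simp [twistDiv_apply, map_one_of_character hr]
    · simp [twistDiv_apply, ArithmeticFunction.one_apply_ne hn]
  have hsum1 (m : ℕ) (hm : 1 ≤ m) :
      ∑ n ∈ Ioc 0 m, (α * twistDiv r (ζ : ArithmeticFunction ℝ)) n = 1 := by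
    rw [hone, sum_eq_single_of_mem 1 (by simpa using hm)
      fun n _ hn => ArithmeticFunction.one_apply_ne hn, ArithmeticFunction.one_one]
  have hC : 0 ≤ C := by simpa using (abs_nonneg _).trans (hL 1 le_rfl)
  have hbdd (m : ℕ) : |∑ n ∈ Ioc 0 m, α n| ≤ (1 + 4 * C) / |L| := by
    rcases Nat.eq_zero_or_pos m with rfl | hm
    · simp only [Ioc_self, sum_empty, abs_zero]; positivity
    have h1 := sum_Ioc_mul_eq_add_sum_error α (twistDiv r (ζ : ArithmeticFunction ℝ)) L m
    rw [hsum1 m hm] at h1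
    have h2 := abs_sum_mul_le_of_inv_sqrt hC hα1 hζ le_rfl (N := m)
    rw [mul_div_assoc, div_self (by positivity), mul_one] at h2
    rw [le_div_iff₀ (abs_pos.2 hL0), ← abs_mul, ← sub_eq_iff_eq_add.2 h1]
    exact (abs_sub _ _).trans (by rw [abs_one]; linarith)
  have hA : Tendsto (fun m => ∑ n ∈ Ioc 0 m, α n) atTop (nhds L⁻¹) := by
    have hd : Differentiable ℂ fun s => DirichletCharacter.LFunction ψ (1 + s) :=
      (DirichletCharacter.differentiable_LFunction hψ).comp (differentiable_id.const_add 1)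
    refine tendsto_sum_of_LSeries_eq hα1 hbdd
      (F := fun s => (DirichletCharacter.LFunction ψ (1 + s))⁻¹)
      (U := {s | DirichletCharacter.LFunction ψ (1 + s) ≠ 0})
      (isOpen_ne_fun hd.continuous continuous_const) (fun s hs => ?_)
      (hd.differentiableOn.inv fun s hs => hs) (by simp [hLF])
      fun s hs => LSeries_twistDiv_moebius hr hs
    exact DirichletCharacter.LFunction_ne_zero_of_one_le_re ψ (Or.inl hψ) (by simpa using hs)
  refine ⟨L, B, hLt, hlim hB, ?_⟩
  have h := tendsto_sum_mul_of_inv_sqrt hα1 hA hlog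
  rw [hα, ← twistDiv_mul hmul, moebius_mul_log_eq_vonMangoldt, inv_mul_eq_div] at h
  exact h

end Twist

section PrimePowers

open Finset
open ArithmeticFunction hiding log

lemma summable_log_div_mul_sub_one :
    Summable fun n : ℕ => if n.Prime then Real.log n / (n * (n - 1)) else 0 := by
  have h1 : Summable fun n : ℕ => 4 * (n : ℝ) ^ (-(3 / 2) : ℝ) :=
    (Real.summable_nat_rpow.2 (by norm_num)).mul_left 4
  refine Summable.of_nonneg_of_le (fun n => ?_) (fun n => ?_) h1
  · split_ifs with hn
    · have : (1 : ℝ) < n := by exact_mod_cast hn.one_lt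
      have : (0 : ℝ) < n - 1 := by linarith
      positivity
    · exact le_rfl
  · split_ifs with hn
    · have h2 : (2 : ℝ) ≤ n := by exact_mod_cast hn.two_le
      have h0 : (0 : ℝ) < n := by linarith
      have h3 := Real.log_le_rpow_div h0.le (ε := 1 / 2) (by norm_num)
      have h4 : (n : ℝ) * (n / 2) ≤ n * (n - 1) := by nlinarith
      calc Real.log n / (n * (n - 1)) ≤ ((n : ℝ) ^ (1 / 2 : ℝ) / (1 / 2)) / (n * (n / 2)) := by
            gcongr
        _ = 4 * ((n : ℝ) ^ (1 / 2 : ℝ) / (n : ℝ) ^ (2 : ℝ)) := by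
            rw [Real.rpow_two]; field_simp; norm_num
        _ = _ := by rw [← Real.rpow_sub h0]; norm_num
    · positivity

lemma summable_non_prime_mul_vonMangoldt_div {r : ℕ → ℝ} (hr : ∀ n, |r n| ≤ 1) :
    Summable fun n : ℕ => if n.Prime then 0 else r n * (Λ n / n) := by
  have h := vonMangoldt.summable_residueClass_non_primes_div (q := 1) 0
  refine Summable.of_norm_bounded h fun n => ?_
  have h1 : vonMangoldt.residueClass (0 : ZMod 1) n = Λ n := by
    simp [vonMangoldt.residueClass, Subsingleton.elim (n : ZMod 1) 0]
  rw [h1]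
  split_ifs
  · simp
  · rw [norm_mul, Real.norm_of_nonneg (div_nonneg vonMangoldt_nonneg (Nat.cast_nonneg n))]
    exact mul_le_of_le_one_left (div_nonneg vonMangoldt_nonneg (Nat.cast_nonneg n)) (hr n)

lemma tsum_non_prime_mul_vonMangoldt_div {r : ℕ → ℝ} (hr : ∀ n, |r n| ≤ 1)
    (hone : r 1 = 1) (hmul : ∀ m n, r (m * n) = r m * r n) :
    ∑' n : ℕ, (if n.Prime then 0 else r n * (Λ n / n)) =
      ∑' n : ℕ, if n.Prime then r n ^ 2 * Real.log n / (n * (n - r n)) else 0 := by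
  rw [tsum_eq_tsum_primes_of_support_subset_prime_powers
    (summable_non_prime_mul_vonMangoldt_div hr)]
  · refine Eq.trans ?_ ((tsum_subtype {p : ℕ | p.Prime}
      fun n : ℕ => r n ^ 2 * Real.log n / (n * (n - r n))).trans
      (tsum_congr fun n => by simp [Set.indicator_apply]))
    refine tsum_congr fun p => ?_
    have hp := p.2
    have hp1 : (1 : ℝ) < (p : ℕ) := by exact_mod_cast hp.one_lt
    have hp0 : ((p : ℕ) : ℝ) ≠ 0 := by linarith
    have hpow (k : ℕ) : r ((p : ℕ) ^ k) = r p ^ k := by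
      induction k with
      | zero => simpa using hone
      | succ k ih => rw [pow_succ, hmul, ih, pow_succ]
    have hrp := abs_le.1 (hr p)
    have hgeo : HasSum (fun k : ℕ => r p ^ 2 * Real.log p / (p : ℕ) ^ 2 * (r p / (p : ℕ)) ^ k)
        (r p ^ 2 * Real.log p / (p : ℕ) ^ 2 * (1 - r p / (p : ℕ))⁻¹) := by
      refine (hasSum_geometric_of_abs_lt_one ?_).mul_left _
      rw [abs_div, Nat.abs_cast, div_lt_one (by linarith)]
      exact (hr p).trans_lt hp1
    have heq : (fun k : ℕ => if ((p : ℕ) ^ (k + 1 + 1)).Prime then 0 else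
        r ((p : ℕ) ^ (k + 1 + 1)) * (Λ ((p : ℕ) ^ (k + 1 + 1)) / ((p : ℕ) ^ (k + 1 + 1) : ℕ))) =
        fun k : ℕ => r p ^ 2 * Real.log p / (p : ℕ) ^ 2 * (r p / (p : ℕ)) ^ k := by
      ext k
      rw [if_neg (Nat.Prime.not_prime_pow (by lia)), hpow,
        vonMangoldt_apply_pow (by lia), vonMangoldt_apply_prime hp, div_pow]
      push_cast
      field_simp
      ring
    have hs := (hasSum_nat_add_iff (f := fun k : ℕ => if ((p : ℕ) ^ (k + 1)).Prime then 0 else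
        r ((p : ℕ) ^ (k + 1)) * (Λ ((p : ℕ) ^ (k + 1)) / ((p : ℕ) ^ (k + 1) : ℕ))) 1).1
        (heq ▸ hgeo)
    rw [hs.tsum_eq]
    have h0 : (p : ℝ) - r p ≠ 0 := by linarith
    simp [hp]
    field_simp
  · intro n hn
    contrapose! hn
    simp [vonMangoldt_eq_zero_iff.2 hn]

/-- Passing from prime powers to primes in the sum of `χ(n) Λ(n)/n`. -/
theorem tendsto_sum_primes_of_tendsto_sum_vonMangoldt {r : ℕ → ℝ} {k : ℕ → ℤ} {X : ℝ}
    (hr : ∀ n, |r n| ≤ 1) (hone : r 1 = 1) (hmul : ∀ m n, r (m * n) = r m * r n)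
    (hrk : ∀ p : ℕ, p.Prime → r p = k p) (hk : ∀ p : ℕ, p.Prime → k p = 0 ∨ k p = 1 ∨ k p = -1)
    (hX : Tendsto (fun m => ∑ n ∈ Ioc 0 m, r n * (Λ n / n)) atTop (nhds X)) :
    Summable (fun p : {p : ℕ // p.Prime ∧ k p = -1} => 2 * Real.log p / ((p : ℝ) ^ 2 - 1)) ∧
      Tendsto (fun m : ℕ => ∑ p ∈ (Icc 1 m).filter Nat.Prime,
          (k p : ℝ) * Real.log p / ((p : ℝ) - 1)) atTop
        (nhds (X - ∑' p : {p : ℕ // p.Prime ∧ k p = -1},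
          2 * Real.log p / ((p : ℝ) ^ 2 - 1))) := by
  set g : ℕ → ℝ := fun n => if n.Prime then 0 else r n * (Λ n / n) with hg
  set d : ℕ → ℝ := fun n => if n.Prime then r n ^ 2 * Real.log n / (n * (n - r n)) else 0 with hd
  set e : ℕ → ℝ := fun n => if n.Prime then r n * Real.log n / (n * (n - 1)) else 0 with he
  have hgs : Summable g := summable_non_prime_mul_vonMangoldt_div hr
  have hgd : ∑' n, g n = ∑' n, d n := tsum_non_prime_mul_vonMangoldt_div hr hone hmul
  have hds : Summable d := by
    refine Summable.of_norm_bounded summable_log_div_mul_sub_one fun n => ?_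
    simp only [hd]
    split_ifs with hn
    · have hn1 : (1 : ℝ) < n := by exact_mod_cast hn.one_lt
      have h1 := abs_le.1 (hr n)
      have h2 : (0 : ℝ) < n - 1 := by linarith
      have h3 : (0 : ℝ) < n - r n := by linarith
      have h4 : 0 ≤ Real.log n := Real.log_natCast_nonneg n
      rw [Real.norm_of_nonneg (by positivity)]
      have h5 : r n ^ 2 ≤ 1 := (sq_le_one_iff_abs_le_one _).2 (hr n)
      calc _ ≤ 1 * Real.log n / (n * (n - 1)) := by
            gcongr
            exact h1.2
        _ = _ := by rw [one_mul]
    · simp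
  have hes : Summable e := by
    refine Summable.of_norm_bounded summable_log_div_mul_sub_one fun n => ?_
    simp only [he]
    split_ifs with hn
    · have hn1 : (1 : ℝ) < n := by exact_mod_cast hn.one_lt
      have h2 : (0 : ℝ) < n - 1 := by linarith
      have h4 : 0 ≤ Real.log n := Real.log_natCast_nonneg n
      rw [mul_div_assoc, norm_mul, Real.norm_of_nonneg (r := _ / _) (by positivity)]
      exact mul_le_of_le_one_left (by positivity) (hr n)
    · simp
  have hu : ({p : ℕ | p.Prime ∧ k p = -1}.indicator
      fun p : ℕ => 2 * Real.log p / ((p : ℝ) ^ 2 - 1)) = fun n => d n - e n := by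
    ext n
    simp only [hd, he, Set.indicator_apply, Set.mem_ofPred_eq]
    by_cases hn : n.Prime
    · have hn1 : (1 : ℝ) < n := by exact_mod_cast hn.one_lt
      have h2 : (n : ℝ) - 1 ≠ 0 := by linarith
      have h3 : (n : ℝ) + 1 ≠ 0 := by linarith
      simp only [hn, true_and, if_true, hrk n hn]
      rcases hk n hn with h | h | h
      · simp [h]
      · simp [h]
      · simp only [h, if_true]
        rw [show (n : ℝ) ^ 2 - 1 = (n - 1) * (n + 1) by ring]
        push_cast
        rw [sub_neg_eq_add]
        field_simp
        ring
    · simp [hn]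
  have hus := hds.sub hes
  rw [← hu] at hus
  refine ⟨summable_subtype_iff_indicator.2 hus, ?_⟩
  have htsum : ∑' p : {p : ℕ // p.Prime ∧ k p = -1}, 2 * Real.log p / ((p : ℝ) ^ 2 - 1) =
      ∑' n, g n - ∑' n, e n := by
    rw [hgd, ← hds.tsum_sub hes, ← hu]
    exact tsum_subtype {p : ℕ | p.Prime ∧ k p = -1}
      fun p : ℕ => 2 * Real.log p / ((p : ℝ) ^ 2 - 1)
  have hpart {f : ℕ → ℝ} (hf : Summable f) (hf0 : f 0 = 0) :
      Tendsto (fun m => ∑ n ∈ Ioc 0 m, f n) atTop (nhds (∑' n, f n)) := by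
    refine (hf.hasSum.tendsto_sum_nat.comp (tendsto_add_atTop_nat 1)).congr fun m => ?_
    rw [Function.comp_apply, Nat.range_succ_eq_Icc_zero, ← Finset.sum_Ioc_add_eq_sum_Icc m.zero_le,
      hf0, add_zero]
  rw [htsum]
  refine ((hX.sub ((hpart hgs (by simp [hg])).sub (hpart hes (by simp [he])))).congr fun m => ?_)
  rw [← sum_sub_distrib, ← sum_sub_distrib, sum_filter]
  refine sum_congr rfl fun n _ => ?_
  simp only [hg, he]
  by_cases hn : n.Prime
  · have hn1 : (1 : ℝ) < n := by exact_mod_cast hn.one_lt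
    have h2 : (n : ℝ) - 1 ≠ 0 := by linarith
    simp only [hn, if_true, hrk n hn, vonMangoldt_apply_prime hn]
    field_simp
    ring
  · simp [hn]

end PrimePowers

section Kronecker

lemma kron_eq_zero_or_one_or_neg_one (D : ℤ) (p : ℕ) :
    kron D p = 0 ∨ kron D p = 1 ∨ kron D p = -1 := by
  unfold kron
  split_ifs
  · simp
  · simp
  · simp
  · exact jacobiSym.trichotomy D p

lemma eq_of_mul_of_prime_eq {f g : ℕ → ℤ} (h0 : f 0 = g 0) (h1 : f 1 = g 1)
    (hf : ∀ m n, f (m * n) = f m * f n) (hg : ∀ m n, g (m * n) = g m * g n)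
    (hp : ∀ p : ℕ, p.Prime → f p = g p) (n : ℕ) : f n = g n := by
  induction n using Nat.recOnMul with
  | zero => exact h0
  | one => exact h1
  | prime p h => exact hp p h
  | mul a b ha hb => rw [hf, hg, ha, hb]

lemma exists_dirichletCharacter_of_periodic {χ : ℕ → ℤ} {N : ℕ} [NeZero N] (h1 : χ 1 = 1)
    (hmul : ∀ m n, χ (m * n) = χ m * χ n) (hper : ∀ n, χ (n % N) = χ n)
    (hdvd : ∀ p : ℕ, p.Prime → p ∣ N → χ p = 0) (hneg : ∃ n, χ n = -1) :
    ∃ ψ : DirichletCharacter ℂ N, ψ ≠ 1 ∧ ∀ n : ℕ, ψ n = ((χ n : ℝ) : ℂ) := by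
  let ψ : DirichletCharacter ℂ N :=
    { toFun := fun a => ((χ a.val : ℝ) : ℂ)
      map_one' := by rw [ZMod.val_one_eq_one_mod, hper, h1]; simp
      map_mul' := fun a b => by rw [ZMod.val_mul, hper, hmul]; push_cast; rfl
      map_nonunit' := fun a ha => by
        rw [← ZMod.natCast_zmod_val a, ZMod.isUnit_iff_coprime, Nat.Prime.not_coprime_iff_dvd] at ha
        obtain ⟨p, hp, ⟨k, hk⟩, hpN⟩ := ha
        rw [hk, hmul, hdvd p hp hpN]
        simp }
  have hψ (n : ℕ) : ψ n = ((χ n : ℝ) : ℂ) := by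
    change ((χ (n : ZMod N).val : ℝ) : ℂ) = _
    rw [ZMod.val_natCast, hper]
  refine ⟨ψ, fun h => ?_, hψ⟩
  obtain ⟨n, hn⟩ := hneg
  have h2 := hψ n
  rw [hn] at h2
  by_cases hu : IsUnit (n : ZMod N)
  · rw [h, MulChar.one_apply hu] at h2
    norm_num at h2
  · rw [ψ.map_nonunit hu] at h2
    norm_num at h2

lemma kron_eq_jacobiSym_natAbs {D : ℤ} (hD : D ≤ -3) (hmod : D % 4 = 1) {p : ℕ} (hp : p.Prime) :
    kron D p = jacobiSym p D.natAbs := by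
  have hNmod : D.natAbs % 4 = 3 := by lia
  have hodd : Odd D.natAbs := Nat.odd_iff.2 (Nat.odd_of_mod_four_eq_three hNmod)
  have hDN : D = -1 * (D.natAbs : ℤ) := by lia
  unfold kron
  split_ifs with h1 h2 h3
  · symm
    rw [jacobiSym.eq_zero_iff]
    refine ⟨by lia, ?_⟩
    rw [Int.gcd_natCast_natCast]
    exact Nat.Prime.not_coprime_iff_dvd.2 ⟨p, hp, dvd_rfl, Int.natCast_dvd.1 h1⟩
  · subst h2
    rw [Nat.cast_ofNat, jacobiSym.at_two hodd, ZMod.χ₈_nat_eq_if_mod_eight,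
      if_neg (by lia), if_pos (by lia)]
  · subst h2
    rw [Nat.cast_ofNat, jacobiSym.at_two hodd, ZMod.χ₈_nat_eq_if_mod_eight,
      if_neg (by lia), if_neg (by lia)]
  · have hpodd : Odd p := hp.odd_of_ne_two h2
    rw [hDN, jacobiSym.mul_left, jacobiSym.at_neg_one hpodd, ← hDN]
    rcases Nat.odd_mod_four_iff.1 (Nat.odd_iff.1 hpodd) with h4 | h4
    · rw [ZMod.χ₄_nat_one_mod_four h4, one_mul,
        jacobiSym.quadratic_reciprocity_one_mod_four h4 hodd]
    · rw [ZMod.χ₄_nat_three_mod_four h4,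
        jacobiSym.quadratic_reciprocity_three_mod_four hNmod h4, neg_one_mul, neg_neg]

lemma exists_dirichletCharacter_of_mod_four_eq_one {D : ℤ} (hD : D ≤ -3) (hmod : D % 4 = 1)
    {χ : ℕ → ℤ} (hχ : IsChiD D χ) : ∃ (N : ℕ) (_ : NeZero N) (ψ : DirichletCharacter ℂ N),
      ψ ≠ 1 ∧ ∀ n : ℕ, ψ n = ((χ n : ℝ) : ℂ) := by
  obtain ⟨h0, h1, hmul, hp⟩ := hχ
  have : NeZero D.natAbs := ⟨by lia⟩
  have hJ (n : ℕ) : χ n = jacobiSym n D.natAbs := by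
    refine eq_of_mul_of_prime_eq (g := fun n : ℕ => jacobiSym n D.natAbs) ?_ ?_ hmul ?_ ?_ n
    · rw [h0, Nat.cast_zero, jacobiSym.zero_left (by lia)]
    · rw [h1, Nat.cast_one, jacobiSym.one_left]
    · intro m n
      simp only [Nat.cast_mul, jacobiSym.mul_left]
    · exact fun p h => (hp p h).trans (kron_eq_jacobiSym_natAbs hD hmod h)
  refine ⟨D.natAbs, this, exists_dirichletCharacter_of_periodic h1 hmul (fun n => ?_)
    (fun p h hdvd => ?_) ⟨D.natAbs - 1, ?_⟩⟩
  · rw [hJ, hJ, Int.natCast_mod, ← jacobiSym.mod_left]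
  · rw [hp p h, kron, if_pos (Int.natCast_dvd.2 hdvd)]
  · have hN : D.natAbs % 4 = 3 := by lia
    have hmod' : ((D.natAbs - 1 : ℕ) : ℤ) % D.natAbs = -1 % D.natAbs := by
      rw [Nat.cast_sub (by lia), Nat.cast_one, sub_eq_neg_add, Int.add_emod_right]
    rw [hJ, jacobiSym.mod_left' hmod',
      jacobiSym.at_neg_one (Nat.odd_iff.2 (Nat.odd_of_mod_four_eq_three hN)),
      ZMod.χ₄_nat_three_mod_four hN]

lemma exists_dirichletCharacter_of_four_dvd {D : ℤ} (hD : D ≤ -3) (hfour : 4 ∣ D)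
    {χ : ℕ → ℤ} (hχ : IsChiD D χ) : ∃ (N : ℕ) (_ : NeZero N) (ψ : DirichletCharacter ℂ N),
      ψ ≠ 1 ∧ ∀ n : ℕ, ψ n = ((χ n : ℝ) : ℂ) := by
  obtain ⟨h0, h1, hmul, hp⟩ := hχ
  have : NeZero (4 * D.natAbs) := ⟨by lia⟩
  have hJ (n : ℕ) : χ n = if n % 2 = 0 then 0 else jacobiSym D n := by
    refine eq_of_mul_of_prime_eq (g := fun n : ℕ => if n % 2 = 0 then 0 else jacobiSym D n)
      ?_ ?_ hmul ?_ ?_ n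
    · simp [h0]
    · simp [h1]
    · intro m n
      rcases Nat.mod_two_eq_zero_or_one m with hm | hm
      · simp [hm, Nat.mul_mod]
      rcases Nat.mod_two_eq_zero_or_one n with hn | hn
      · simp [hn, Nat.mul_mod]
      rw [if_neg (by simp [hm, hn, Nat.mul_mod]), if_neg (by lia), if_neg (by lia),
        jacobiSym.mul_right' _ (by lia) (by lia)]
    · intro p h
      have : NeZero p := ⟨h.ne_zero⟩
      rw [hp p h, kron]
      rcases h.eq_two_or_odd with rfl | hodd
      · rw [if_pos (by push_cast; lia)]
        simp
      · rw [if_neg (by lia : ¬ p % 2 = 0), if_neg (by rintro rfl; lia : ¬ p = 2)]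
        split_ifs with hpD
        · symm
          rw [jacobiSym.eq_zero_iff_not_coprime, Int.gcd_eq_natAbs, Int.natAbs_natCast]
          exact Nat.Prime.not_coprime_iff_dvd.2 ⟨p, h, Int.natCast_dvd.1 hpD, dvd_rfl⟩
        · rfl
  refine ⟨4 * D.natAbs, this, exists_dirichletCharacter_of_periodic h1 hmul (fun n => ?_)
    (fun p h hdvd => ?_) ⟨4 * D.natAbs - 1, ?_⟩⟩
  · rw [hJ, hJ, show n % (4 * D.natAbs) % 2 = n % 2 from
      Nat.mod_mod_of_dvd _ (dvd_mul_of_dvd_left (by norm_num) _)]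
    split_ifs with h
    · rfl
    · exact (jacobiSym.mod_right D (Nat.odd_iff.2 (by lia))).symm
  · rw [hp p h, kron, if_pos]
    rw [Int.natCast_dvd]
    rcases h.dvd_mul.1 hdvd with h | h
    · exact h.trans (Int.natAbs_dvd_natAbs.2 hfour)
    · exact h
  · set n := 4 * D.natAbs - 1 with hn
    have hn4 : n % 4 = 3 := by lia
    have hodd : Odd n := Nat.odd_iff.2 (Nat.odd_of_mod_four_eq_three hn4)
    have hDN : D = -1 * (D.natAbs : ℤ) := by lia
    have h2 : jacobiSym (4 * D.natAbs) n = 1 := by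
      rw [jacobiSym.mod_left' (a₂ := 1), jacobiSym.one_left]
      rw [show (4 * D.natAbs : ℤ) = 1 + n by lia, Int.add_emod_right]
    rw [jacobiSym.mul_left, jacobiSym.at_four hodd, one_mul] at h2
    rw [hJ, if_neg (by lia), hDN, jacobiSym.mul_left, jacobiSym.at_neg_one hodd, h2,
      ZMod.χ₄_nat_three_mod_four hn4, mul_one]

/-- The function `χ_D` is a nontrivial Dirichlet character. -/
theorem IsChiD.exists_dirichletCharacter {D : ℤ} (hD : D ≤ -3) (hfund : IsFundamentalDiscriminant D)
    {χ : ℕ → ℤ} (hχ : IsChiD D χ) : ∃ (N : ℕ) (_ : NeZero N) (ψ : DirichletCharacter ℂ N),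
      ψ ≠ 1 ∧ ∀ n : ℕ, ψ n = ((χ n : ℝ) : ℂ) := by
  rcases hfund with ⟨h, -⟩ | ⟨m, h, -⟩
  · exact exists_dirichletCharacter_of_mod_four_eq_one hD h hχ
  · exact exists_dirichletCharacter_of_four_dvd hD ⟨m, h⟩ hχ

end Kronecker

lemma tendsto_sum_range_of_tendsto_sum_Ioc {f : ℕ → ℝ} {a : ℝ} (h0 : f 0 = 0)
    (h : Tendsto (fun m => ∑ i ∈ Finset.Ioc 0 m, f i) atTop (nhds a)) :
    Tendsto (fun m => ∑ i ∈ Finset.range m, f i) atTop (nhds a) := by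
  refine (tendsto_add_atTop_iff_nat 1).1 (h.congr fun m => ?_)
  rw [Nat.range_succ_eq_Icc_zero, ← Finset.sum_Ioc_add_eq_sum_Icc m.zero_le, h0, add_zero]

/-- For a fundamental discriminant `D ≤ -3`, the limit
`T = lim_{x→∞} ∑_{p ≤ x} (D/p) log p/(p - 1)` exists and
`-T = (L'/L)(1,χ_D) + ∑_{(D/p) = -1} 2 log p/(p² - 1)`, the last sum converging
absolutely; here `L = L(1,χ_D)`, `L' = L'(1,χ_D)` are the limits of the partial sums
of `∑ χ_D(n)/n` and `-∑ χ_D(n) log n / n`. -/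
theorem neg_sum_kron_log_div (D : ℤ) (hD : D ≤ -3)
    (hfund : IsFundamentalDiscriminant D) (χD : ℕ → ℤ) (hχ : IsChiD D χD) :
    ∃ T L L' : ℝ,
      Tendsto (fun N : ℕ => ∑ n ∈ Finset.range N, (χD n : ℝ) / (n : ℝ)) atTop (nhds L) ∧
      Tendsto (fun N : ℕ => -∑ n ∈ Finset.range N, (χD n : ℝ) * Real.log n / (n : ℝ))
        atTop (nhds L') ∧
      Tendsto (fun x : ℝ =>
          ∑ p ∈ (Finset.Icc 1 ⌊x⌋₊).filter Nat.Prime,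
            (kron D p : ℝ) * Real.log p / ((p : ℝ) - 1))
        atTop (nhds T) ∧
      Summable (fun p : {p : ℕ // p.Prime ∧ kron D p = -1} =>
        2 * Real.log p / ((p : ℝ) ^ 2 - 1)) ∧
      -T = L' / L +
        ∑' p : {p : ℕ // p.Prime ∧ kron D p = -1}, 2 * Real.log p / ((p : ℝ) ^ 2 - 1) := by
  obtain ⟨N, _, ψ, hψ, hr⟩ := hχ.exists_dirichletCharacter hD hfund
  obtain ⟨L, B, hL, hB, hX⟩ := exists_tendsto_sum_character_mul_vonMangoldt_div hψ hr
  obtain ⟨hS, hT⟩ := tendsto_sum_primes_of_tendsto_sum_vonMangoldt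
    (abs_le_one_of_character hr) (map_one_of_character hr) (map_mul_of_character hr)
    (fun p hp => by rw [hχ.2.2.2 p hp]) (fun p _ => kron_eq_zero_or_one_or_neg_one D p) hX
  refine ⟨_, L, -B, ?_, ?_, hT.comp (tendsto_nat_floor_atTop (α := ℝ)), hS, by ring⟩
  · exact tendsto_sum_range_of_tendsto_sum_Ioc (by simp) (by simpa only [mul_one_div] using hL)
  · refine (tendsto_sum_range_of_tendsto_sum_Ioc (by simp) ?_).neg
    simpa only [mul_div_assoc] using hB
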